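/- Let r ≥ 1 and let W be a closed subspace of K with S(W) ⊆ W, K_r ⊆ W ⊆ K_{-r}, and dim_ℂ(W ⧸ K_r) = 2r (i.e. W ∈ F_{2r}), and set m := dim_ℂ(W ∩ K₋); assume m > 0. Let x ∈ W be an element of degree -m, let v ∈ ℂ² be the unit vector x(-m)/‖x(-m)‖, and let u ∈ ℂ² be a unit vector orthogonal to v. Define the closed subspace K_λ := {y ∈ K ∣ ⟪y(n), u⟫ = 0 for all n < m and ⟪y(n), v⟫ = 0 for all n < -m} (the model of λ(K₊) for the homomorphism λ(z) = diag(z^m, z^{-m}) in the basis u, v). Then the orthogonal projection of K onto K_λ restricts to a bijection from W onto K_λ. -/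

import Mathlib

noncomputable section

/-- The Hilbert space `K = ℓ²(ℤ, ℂ²)`, the model of `L²(S¹) ⊗ ℂ²`. -/
abbrev KSp := lp (fun _ : ℤ => EuclideanSpace ℂ (Fin 2)) 2

/-- The closed subspace `K_k = {x ∈ K ∣ x n = 0 for all n < k}`, the model of `z^k K₊`. -/
def Ksub (k : ℤ) : Submodule ℂ KSp where
  carrier := {x : KSp | ∀ n : ℤ, n < k → x n = 0}
  add_mem' := by
    intro a b ha hb n hn
    simp only [Set.mem_setOf_eq] at ha hb
    simp [lp.coeFn_add, Pi.add_apply, ha n hn, hb n hn]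
  zero_mem' := by
    intro n hn
    simp [lp.coeFn_zero]
  smul_mem' := by
    intro c a ha n hn
    simp only [Set.mem_setOf_eq] at ha
    simp [lp.coeFn_smul, Pi.smul_apply, ha n hn]

/-- The closed subspace `K₋ = {x ∈ K ∣ x n = 0 for all n ≥ 0}`. -/
def Kneg : Submodule ℂ KSp where
  carrier := {x : KSp | ∀ n : ℤ, 0 ≤ n → x n = 0}
  add_mem' := by
    intro a b ha hb n hn
    simp only [Set.mem_setOf_eq] at ha hb
    simp [lp.coeFn_add, Pi.add_apply, ha n hn, hb n hn]
  zero_mem' := by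
    intro n hn
    simp [lp.coeFn_zero]
  smul_mem' := by
    intro c a ha n hn
    simp only [Set.mem_setOf_eq] at ha
    simp [lp.coeFn_smul, Pi.smul_apply, ha n hn]

/-- The closed subspace `K_λ` associated to the homomorphism
`λ(z) = diag (z^m, z^{-m})` in an orthonormal basis `u, v` of `ℂ²`:
`K_λ = {y ∣ y n ⊥ u for n < m, and y n ⊥ v for n < -m}`. -/
def Klambda (m : ℕ) (u v : EuclideanSpace ℂ (Fin 2)) : Set KSp :=
  {y : KSp | (∀ n : ℤ, n < (m : ℤ) → inner (𝕜 := ℂ) (y n) u = 0) ∧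
    (∀ n : ℤ, n < -(m : ℤ) → inner (𝕜 := ℂ) (y n) v = 0)}

/-- Sequences vanishing from `N` on. -/
def Kup (N : ℤ) : Submodule ℂ KSp where
  carrier := {x : KSp | ∀ n : ℤ, N ≤ n → x n = 0}
  add_mem' := by
    intro a b ha hb n hn
    simp only [Set.mem_setOf_eq] at ha hb
    simp [lp.coeFn_add, Pi.add_apply, ha n hn, hb n hn]
  zero_mem' := by
    intro n hn
    simp [lp.coeFn_zero]
  smul_mem' := by
    intro c a ha n hn
    simp only [Set.mem_setOf_eq] at ha
    simp [lp.coeFn_smul, Pi.smul_apply, ha n hn]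

/-- Coordinate evaluation. -/
def evL (n : ℤ) : KSp →ₗ[ℂ] EuclideanSpace ℂ (Fin 2) where
  toFun y := y n
  map_add' := by intro a b; simp [lp.coeFn_add]
  map_smul' := by intro c a; simp [lp.coeFn_smul]

/-- Coordinate evaluation followed by inner product with `u`. -/
def coefL (u : EuclideanSpace ℂ (Fin 2)) (n : ℤ) : KSp →ₗ[ℂ] ℂ :=
  (innerSL ℂ u).toLinearMap ∘ₗ evL n

lemma coefL_apply (u : EuclideanSpace ℂ (Fin 2)) (n : ℤ) (y : KSp) :
    coefL u n y = inner ℂ u (y n) := rfl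

instance finDim_trunc (a b : ℤ) : FiniteDimensional ℂ ↥(Ksub a ⊓ Kup b) := by
  let f : ↥(Ksub a ⊓ Kup b) →ₗ[ℂ] (↥(Finset.Ico a b) → EuclideanSpace ℂ (Fin 2)) :=
    LinearMap.pi fun n => (evL n.1) ∘ₗ (Ksub a ⊓ Kup b).subtype
  apply FiniteDimensional.of_injective f
  rw [← LinearMap.ker_eq_bot, LinearMap.ker_eq_bot']
  rintro ⟨y, hy⟩ h
  ext1
  apply lp.ext
  funext n
  rw [Submodule.mem_inf] at hy
  obtain ⟨h1, h2⟩ := hy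
  by_cases hn : n < a
  · exact h1 n hn
  by_cases hn2 : b ≤ n
  · exact h2 n hn2
  exact congrFun h ⟨n, by simp; omega⟩

/-- The finite head of a sequence. -/
def headK (r : ℕ) (y : KSp) : KSp :=
  ∑ n ∈ Finset.Ico (-(r : ℤ)) r, lp.single 2 n (y n)

lemma headK_apply (r : ℕ) (y : KSp) (n : ℤ) :
    headK r y n = if n ∈ Finset.Ico (-(r : ℤ)) r then y n else 0 := by
  have : headK r y n = ∑ k ∈ Finset.Ico (-(r : ℤ)) r, evL n (lp.single 2 k (y k)) := by
    rw [← map_sum]; rfl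
  rw [this]
  have h2 : ∀ k, evL n (lp.single 2 k (y k)) = if n = k then y n else 0 := by
    intro k
    change (lp.single 2 k (y k) : KSp) n = _
    by_cases h : n = k
    · subst h; simp
    · simp [h]
  simp only [h2]
  rw [Finset.sum_ite_eq]

lemma finrank_trunc (r : ℕ) (W : Submodule ℂ KSp)
    (hlow : Ksub (r : ℤ) ≤ W) (hhigh : W ≤ Ksub (-(r : ℤ))) :
    Module.finrank ℂ ↥(W ⊓ Kup r) =
      Module.finrank ℂ (↥W ⧸ (Ksub (r : ℤ)).comap W.subtype) := by
  let f : ↥(W ⊓ Kup r) →ₗ[ℂ] (↥W ⧸ (Ksub (r : ℤ)).comap W.subtype) :=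
    (Submodule.mkQ _) ∘ₗ Submodule.inclusion inf_le_left
  refine LinearEquiv.finrank_eq (LinearEquiv.ofBijective f ⟨?_, ?_⟩)
  · rw [← LinearMap.ker_eq_bot, LinearMap.ker_eq_bot']
    rintro ⟨y, hy⟩ h
    have h' : y ∈ Ksub (r : ℤ) := by
      have := (Submodule.Quotient.mk_eq_zero _).1 h
      exact this
    rw [Submodule.mem_inf] at hy
    ext1
    apply lp.ext
    funext n
    by_cases hn : n < r
    · exact h' n hn
    · exact hy.2 n (by omega)
  · intro q
    obtain ⟨⟨y, hy⟩, rfl⟩ := Submodule.mkQ_surjective _ q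
    have hk : y - headK r y ∈ Ksub (r : ℤ) := by
      intro n hn
      rw [lp.coeFn_sub, Pi.sub_apply, headK_apply]
      split_ifs with h
      · simp
      · rw [hhigh hy n (by simp at h; omega)]; simp
    have hw : headK r y ∈ W := by
      have := W.sub_mem hy (hlow hk)
      simpa using this
    refine ⟨⟨headK r y, hw, ?_⟩, ?_⟩
    · intro n hn
      rw [headK_apply, if_neg (by simp; omega)]
    · symm
      refine (Submodule.Quotient.eq _).2 ?_
      exact hk

lemma eq_zero_of_orth (u v z : EuclideanSpace ℂ (Fin 2)) (hu : ‖u‖ = 1) (hv : ‖v‖ = 1)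
    (huv : inner ℂ u v = 0) (h1 : inner ℂ u z = 0) (h2 : inner ℂ v z = 0) : z = 0 := by
  have ho : Orthonormal ℂ ![u, v] := by
    simp [hu, hv, huv]
  have hs := ho.linearIndependent.span_eq_top_of_card_eq_finrank (by simp)
  have hz : z ∈ (Submodule.span ℂ (Set.range ![u, v]))ᗮ := by
    rw [Submodule.mem_orthogonal]
    intro a ha
    induction ha using Submodule.span_induction with
    | mem a ha =>
      obtain ⟨i, rfl⟩ := ha
      fin_cases i
      · exact h1
      · exact h2
    | zero => simp
    | add a b _ _ ha hb => rw [inner_add_left, ha, hb, add_zero]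
    | smul c a _ ha => rw [inner_smul_left, ha, mul_zero]
  rw [hs] at hz
  simpa using hz

lemma iter_apply (S : KSp ≃ₗᵢ[ℂ] KSp) (hS : ∀ (x : KSp) (n : ℤ), (S x) n = x (n - 1))
    (j : ℕ) (x : KSp) (n : ℤ) : (S^[j] x) n = x (n - j) := by
  induction j generalizing n with
  | zero => simp
  | succ j ih => rw [Function.iterate_succ_apply', hS, ih, show n - 1 - (j : ℤ) = n - ((j + 1 : ℕ) : ℤ) by push_cast; ring]

lemma iter_mem (S : KSp ≃ₗᵢ[ℂ] KSp) (W : Submodule ℂ KSp) (hSW : ∀ x ∈ W, S x ∈ W)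
    (j : ℕ) (x : KSp) (hx : x ∈ W) : S^[j] x ∈ W := by
  induction j with
  | zero => simpa
  | succ j ih => rw [Function.iterate_succ_apply']; exact hSW _ ih

lemma inj_key
    (r : ℕ)
    (S : KSp ≃ₗᵢ[ℂ] KSp) (hS : ∀ (x : KSp) (n : ℤ), (S x) n = x (n - 1))
    (W : Submodule ℂ KSp)
    (hSW : ∀ x ∈ W, S x ∈ W)
    (hhigh : W ≤ Ksub (-(r : ℤ)))
    (hdim : Module.finrank ℂ ↥(W ⊓ Kup r) = 2 * r)
    (m : ℕ) (hm : m = Module.finrank ℂ ↥(W ⊓ Kup 0)) (hmr : m ≤ r)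
    (x : KSp) (hxW : x ∈ W) (hxtop : ∀ n : ℤ, -(m : ℤ) < n → x n = 0)
    (hx0 : x (-(m : ℤ)) ≠ 0)
    (u v : EuclideanSpace ℂ (Fin 2))
    (hu : ‖u‖ = 1) (hv : ‖v‖ = 1) (huv : inner ℂ u v = 0)
    (hux : inner ℂ u (x (-(m : ℤ))) = 0)
    (w : KSp) (hw : w ∈ W) (h1 : ∀ n : ℤ, (m : ℤ) ≤ n → inner ℂ u (w n) = 0)
    (h2 : ∀ n : ℤ, -(m : ℤ) ≤ n → inner ℂ v (w n) = 0) : w = 0 := by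
  by_contra hne
  have hfin : ∀ N, FiniteDimensional ℂ ↥(W ⊓ Kup N) := fun N =>
    Submodule.finiteDimensional_of_le (inf_le_inf_right (Kup N) hhigh)
  have hex : ∃ n, w n ≠ 0 := by
    by_contra! h
    exact hne (lp.ext (funext h))
  have hbd : ∀ n : ℤ, w n ≠ 0 → n ≤ m := by
    intro n hn
    by_contra! h
    exact hn (eq_zero_of_orth u v _ hu hv huv (h1 n (by omega)) (h2 n (by omega)))
  obtain ⟨d, hd0, hdtop⟩ := Int.exists_greatest_of_bdd ⟨m, hbd⟩ hex
  have hdm : d < m := by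
    by_contra! h
    exact hd0 (eq_zero_of_orth u v _ hu hv huv (h1 d (by omega)) (h2 d (by omega)))
  have hwtop : ∀ n, d < n → w n = 0 := by
    intro n hn
    by_contra h
    have := hdtop n h
    omega
  have hmono : ∀ N, W ⊓ Kup N ≤ W ⊓ Kup (N + 1) := by
    intro N y hy
    exact ⟨hy.1, fun n hn => hy.2 n (by omega)⟩
  have hxj : ∀ N : ℤ, -(m : ℤ) ≤ N → ∃ y ∈ W ⊓ Kup (N + 1), y N = x (-(m : ℤ)) := by
    intro N hN
    have hj : ((N + m).toNat : ℤ) = N + m := Int.toNat_of_nonneg (by omega)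
    refine ⟨S^[(N + m).toNat] x, ⟨iter_mem S W hSW _ x hxW, ?_⟩, ?_⟩
    · intro n hn
      rw [iter_apply S hS, hj]
      exact hxtop _ (by omega)
    · rw [iter_apply S hS, hj]
      rw [show N - (N + (m : ℤ)) = -(m : ℤ) by ring]
  have step1 : ∀ N : ℤ, -(m : ℤ) ≤ N →
      Module.finrank ℂ ↥(W ⊓ Kup N) + 1 ≤ Module.finrank ℂ ↥(W ⊓ Kup (N + 1)) := by
    intro N hN
    have := hfin (N + 1)
    refine Submodule.finrank_lt_finrank_of_lt (lt_of_le_of_ne (hmono N) ?_)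
    intro he
    obtain ⟨y, hy, hyN⟩ := hxj N hN
    rw [← he] at hy
    exact hx0 (hyN ▸ hy.2 N le_rfl)
  have iter1 : ∀ k : ℕ, Module.finrank ℂ ↥(W ⊓ Kup (-(m : ℤ))) + k ≤
      Module.finrank ℂ ↥(W ⊓ Kup (-(m : ℤ) + k)) := by
    intro k
    induction k with
    | zero => rw [Nat.cast_zero, add_zero, add_zero]
    | succ k ih =>
      have := step1 (-(m : ℤ) + k) (by omega)
      have e : -(m : ℤ) + ((k + 1 : ℕ) : ℤ) = -(m : ℤ) + k + 1 := by push_cast; ring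
      rw [e]
      omega
  by_cases hdlow : d < -(m : ℤ)
  · have hpos : 0 < Module.finrank ℂ ↥(W ⊓ Kup (-(m : ℤ))) := by
      have := hfin (-(m : ℤ))
      have : Nontrivial ↥(W ⊓ Kup (-(m : ℤ))) := by
        refine ⟨⟨⟨w, hw, fun n hn => hwtop n (by omega)⟩, 0, ?_⟩⟩
        intro h
        exact hne (congrArg Subtype.val h)
      exact Module.finrank_pos
    have := iter1 m
    rw [neg_add_cancel, ← hm] at this
    omega
  push Not at hdlow
  have hud : inner ℂ u (w d) ≠ 0 := fun h =>
    hd0 (eq_zero_of_orth u v _ hu hv huv h (h2 d hdlow))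
  have step2 : ∀ N : ℤ, d ≤ N →
      Module.finrank ℂ ↥(W ⊓ Kup N) + 2 ≤ Module.finrank ℂ ↥(W ⊓ Kup (N + 1)) := by
    intro N hN
    have i1 := hfin (N + 1)
    have i2 : FiniteDimensional ℂ ↥(W ⊓ Kup (N + 1) ⊓ LinearMap.ker (coefL u N)) :=
      Submodule.finiteDimensional_of_le inf_le_left
    have a1 : W ⊓ Kup N < W ⊓ Kup (N + 1) ⊓ LinearMap.ker (coefL u N) := by
      refine lt_of_le_of_ne (le_inf (hmono N) ?_) ?_
      · intro y hy
        rw [LinearMap.mem_ker, coefL_apply, hy.2 N le_rfl, inner_zero_right]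
      · intro he
        obtain ⟨y, hy, hyN⟩ := hxj N (by omega)
        have : y ∈ W ⊓ Kup N := by
          rw [he]
          refine ⟨hy, ?_⟩
          rw [SetLike.mem_coe, LinearMap.mem_ker, coefL_apply, hyN, hux]
        exact hx0 (hyN ▸ this.2 N le_rfl)
    have a2 : W ⊓ Kup (N + 1) ⊓ LinearMap.ker (coefL u N) < W ⊓ Kup (N + 1) := by
      refine lt_of_le_of_ne inf_le_left ?_
      intro he
      have hj : ((N - d).toNat : ℤ) = N - d := Int.toNat_of_nonneg (by omega)
      have hy : S^[(N - d).toNat] w ∈ W ⊓ Kup (N + 1) := by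
        refine ⟨iter_mem S W hSW _ w hw, ?_⟩
        intro n hn
        rw [iter_apply S hS, hj]
        exact hwtop _ (by omega)
      rw [← he] at hy
      have := hy.2
      rw [SetLike.mem_coe, LinearMap.mem_ker, coefL_apply, iter_apply S hS, hj,
        sub_sub_cancel] at this
      exact hud this
    have b1 := Submodule.finrank_lt_finrank_of_lt a1
    have b2 := Submodule.finrank_lt_finrank_of_lt a2
    omega
  have iter2 : ∀ k : ℕ, Module.finrank ℂ ↥(W ⊓ Kup d) + 2 * k ≤
      Module.finrank ℂ ↥(W ⊓ Kup (d + k)) := by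
    intro k
    induction k with
    | zero => rw [Nat.cast_zero, add_zero]; omega
    | succ k ih =>
      have := step2 (d + k) (by omega)
      have e : d + ((k + 1 : ℕ) : ℤ) = d + k + 1 := by push_cast; ring
      rw [e]
      omega
  have c1 := iter1 (d + m).toNat
  have c2 := iter2 (r - d).toNat
  have e1 : ((d + m).toNat : ℤ) = d + m := Int.toNat_of_nonneg (by omega)
  have e2 : ((r - d).toNat : ℤ) = r - d := Int.toNat_of_nonneg (by omega)
  rw [e1, show -(m : ℤ) + (d + m) = d by ring] at c1
  rw [e2, show d + ((r : ℤ) - d) = r by ring, hdim] at c2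
  omega

/-- Let `W ∈ F_{2r}` (with `r ≥ 1`) have rank `m > 0`, let `x ∈ W` have
degree `-m`, let `v = x(-m)/‖x(-m)‖`, and let `u` be a unit vector orthogonal to `v`.
Then the orthogonal projection of `K` onto `K_λ` restricts to a bijection from `W`
onto `K_λ`. -/
theorem orthogonalProjection_bijOn_Klambda
    (r : ℕ) (hr : 1 ≤ r)
    (S : KSp ≃ₗᵢ[ℂ] KSp) (hS : ∀ (x : KSp) (n : ℤ), (S x) n = x (n - 1))
    (W : Submodule ℂ KSp) (hWclosed : IsClosed (W : Set KSp))
    (hSW : ∀ x ∈ W, S x ∈ W)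
    (hlow : Ksub (r : ℤ) ≤ W) (hhigh : W ≤ Ksub (-(r : ℤ)))
    (hdim : Module.finrank ℂ (↥W ⧸ (Ksub (r : ℤ)).comap W.subtype) = 2 * r)
    (m : ℕ) (hm : m = Module.finrank ℂ ↥(W ⊓ Kneg)) (hmpos : 0 < m)
    (x : KSp) (hxW : x ∈ W) (hxtop : ∀ n : ℤ, -(m : ℤ) < n → x n = 0)
    (hx0 : x (-(m : ℤ)) ≠ 0)
    (u v : EuclideanSpace ℂ (Fin 2))
    (hv : v = ((‖x (-(m : ℤ))‖ : ℂ))⁻¹ • x (-(m : ℤ)))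
    (hu : ‖u‖ = 1) (huv : inner (𝕜 := ℂ) u v = 0)
    (P : KSp → KSp)
    (hPmem : ∀ y : KSp, P y ∈ Klambda m u v)
    (hPorth : ∀ y : KSp, ∀ w ∈ Klambda m u v, inner (𝕜 := ℂ) (y - P y) w = 0) :
    Set.BijOn P (W : Set KSp) (Klambda m u v) := by
  have hnx : ‖x (-(m : ℤ))‖ ≠ 0 := norm_ne_zero_iff.2 hx0
  have hv1 : ‖v‖ = 1 := by
    rw [hv, norm_smul, norm_inv, Complex.norm_real, norm_norm, inv_mul_cancel₀ hnx]
  have hux : inner ℂ u (x (-(m : ℤ))) = 0 := by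
    rw [hv, inner_smul_right] at huv
    rcases mul_eq_zero.1 huv with h | h
    · exact absurd h (inv_ne_zero (by exact_mod_cast hnx))
    · exact h
  have hmr : m ≤ r := by
    by_contra! h
    exact hx0 (hhigh hxW _ (by omega))
  have hdim' : Module.finrank ℂ ↥(W ⊓ Kup r) = 2 * r := by
    rw [finrank_trunc r W hlow hhigh, hdim]
  have hm' : m = Module.finrank ℂ ↥(W ⊓ Kup 0) := hm
  have key := inj_key r S hS W hSW hhigh hdim' m hm' hmr x hxW hxtop hx0 u v hu hv1 huv hux
  have hvu : inner ℂ v u = 0 := inner_eq_zero_symm.1 huv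
  -- orthogonality to the subspace, in coordinates
  have horth : ∀ y : KSp, (∀ n : ℤ, (m : ℤ) ≤ n → inner ℂ u ((y - P y : KSp) n) = 0) ∧
      (∀ n : ℤ, -(m : ℤ) ≤ n → inner ℂ v ((y - P y : KSp) n) = 0) := by
    intro y
    constructor
    · intro n hn
      have hmem : (lp.single 2 n u : KSp) ∈ Klambda m u v := by
        constructor
        · intro k hk
          have : k ≠ n := by omega
          simp [this]
        · intro k hk
          have : k ≠ n := by omega
          simp [this]
      have := hPorth y _ hmem
      rw [lp.inner_single_right] at this
      exact inner_eq_zero_symm.1 this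
    · intro n hn
      have hmem : (lp.single 2 n v : KSp) ∈ Klambda m u v := by
        constructor
        · intro k hk
          by_cases h : k = n
          · subst h; simpa using hvu
          · simp [h]
        · intro k hk
          have : k ≠ n := by omega
          simp [this]
      have := hPorth y _ hmem
      rw [lp.inner_single_right] at this
      exact inner_eq_zero_symm.1 this
  -- uniqueness
  have huniq : ∀ y z : KSp, z ∈ Klambda m u v →
      (∀ n : ℤ, (m : ℤ) ≤ n → inner ℂ u ((y - z : KSp) n) = 0) →
      (∀ n : ℤ, -(m : ℤ) ≤ n → inner ℂ v ((y - z : KSp) n) = 0) → P y = z := by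
    intro y z hz h1 h2
    obtain ⟨g1, g2⟩ := horth y
    obtain ⟨p1, p2⟩ := hPmem y
    obtain ⟨z1, z2⟩ := hz
    apply lp.ext
    funext n
    rw [← sub_eq_zero]
    apply eq_zero_of_orth u v _ hu hv1 huv
    · rw [inner_sub_right]
      by_cases hn : n < m
      · rw [inner_eq_zero_symm.1 (p1 n hn), inner_eq_zero_symm.1 (z1 n hn), sub_zero]
      · have a := g1 n (by omega)
        have b := h1 n (by omega)
        rw [lp.coeFn_sub, Pi.sub_apply, inner_sub_right] at a b
        linear_combination b - a
    · rw [inner_sub_right]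
      by_cases hn : n < -(m : ℤ)
      · rw [inner_eq_zero_symm.1 (p2 n hn), inner_eq_zero_symm.1 (z2 n hn), sub_zero]
      · have a := g2 n (by omega)
        have b := h2 n (by omega)
        rw [lp.coeFn_sub, Pi.sub_apply, inner_sub_right] at a b
        linear_combination b - a
  refine ⟨fun y _ => hPmem y, ?_, ?_⟩
  · intro y hy z hz hyz
    rw [← sub_eq_zero]
    apply key _ (W.sub_mem hy hz)
    · intro n hn
      have a := (horth y).1 n hn
      have b := (horth z).1 n hn
      rw [← hyz] at b
      rw [lp.coeFn_sub, Pi.sub_apply, inner_sub_right] at a b ⊢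
      linear_combination a - b
    · intro n hn
      have a := (horth y).2 n hn
      have b := (horth z).2 n hn
      rw [← hyz] at b
      rw [lp.coeFn_sub, Pi.sub_apply, inner_sub_right] at a b ⊢
      linear_combination a - b
  · intro y hy
    have hylow : ∀ n : ℤ, n < -(m : ℤ) → y n = 0 := fun n hn =>
      eq_zero_of_orth u v _ hu hv1 huv (inner_eq_zero_symm.1 (hy.1 n (by omega)))
        (inner_eq_zero_symm.1 (hy.2 n hn))
    let L : ↥(W ⊓ Kup r) →ₗ[ℂ]
        (↥(Finset.Ico (m : ℤ) r) → ℂ) × (↥(Finset.Ico (-(m : ℤ)) r) → ℂ) :=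
      LinearMap.prod (LinearMap.pi fun n => coefL u n.1 ∘ₗ (W ⊓ Kup r).subtype)
        (LinearMap.pi fun n => coefL v n.1 ∘ₗ (W ⊓ Kup r).subtype)
    have hLinj : Function.Injective L := by
      rw [← LinearMap.ker_eq_bot, LinearMap.ker_eq_bot']
      rintro ⟨w, hw⟩ h
      ext1
      apply key w hw.1
      · intro n hn
        by_cases hnr : n < r
        · exact congrFun (congrArg Prod.fst h) ⟨n, by simp; omega⟩
        · rw [hw.2 n (by omega), inner_zero_right]
      · intro n hn
        by_cases hnr : n < r
        · exact congrFun (congrArg Prod.snd h) ⟨n, by simp; omega⟩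
        · rw [hw.2 n (by omega), inner_zero_right]
    have hfd : FiniteDimensional ℂ ↥(W ⊓ Kup r) :=
      Submodule.finiteDimensional_of_le (inf_le_inf_right (Kup r) hhigh)
    have hLsurj : Function.Surjective L := by
      refine (LinearMap.injective_iff_surjective_of_finrank_eq_finrank ?_).1 hLinj
      rw [hdim', Module.finrank_prod, Module.finrank_fintype_fun_eq_card,
        Module.finrank_fintype_fun_eq_card, Fintype.card_coe, Fintype.card_coe, Int.card_Ico,
        Int.card_Ico]
      omega
    obtain ⟨⟨w, hw⟩, hLw⟩ := hLsurj (fun n => coefL u n.1 y, fun n => coefL v n.1 y)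
    have hk : y - headK r y ∈ Ksub (r : ℤ) := by
      intro n hn
      rw [lp.coeFn_sub, Pi.sub_apply, headK_apply]
      split_ifs with h
      · simp
      · rw [hylow n (by simp at h; omega)]; simp
    refine ⟨w + (y - headK r y), W.add_mem hw.1 (hlow hk), ?_⟩
    have hdiff : w + (y - headK r y) - y = w - headK r y := by abel
    apply huniq _ _ hy
    · intro n hn
      rw [hdiff, lp.coeFn_sub, Pi.sub_apply, headK_apply]
      by_cases hnr : n < r
      · have := congrFun (congrArg Prod.fst hLw) ⟨n, by simp; omega⟩
        have this2 : inner ℂ u (w n) = inner ℂ u (y n) := this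
        rw [if_pos (by simp; omega), inner_sub_right, this2, sub_self]
      · rw [if_neg (by simp; omega), hw.2 n (by omega), sub_zero, inner_zero_right]
    · intro n hn
      rw [hdiff, lp.coeFn_sub, Pi.sub_apply, headK_apply]
      by_cases hnr : n < r
      · have := congrFun (congrArg Prod.snd hLw) ⟨n, by simp; omega⟩
        have this2 : inner ℂ v (w n) = inner ℂ v (y n) := this
        rw [if_pos (by simp; omega), inner_sub_right, this2, sub_self]
      · rw [if_neg (by simp; omega), hw.2 n (by omega), sub_zero, inner_zero_right]

end
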